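/- arXiv:2605.03289 — 7 statements merged into one kernel-verified Lean document; each statement's English description precedes it below -/
import Mathlib

section
/- Let μ be Lebesgue measure on ℝ^d, let f₀, f₁ : ℝ^d → [0,∞) be measurable probability densities with respect to μ, let π₀, π₁ > 0 with π₀ + π₁ = 1, and let 0 < b ≤ 1/π₀. Suppose γ* ≥ 0 is such that the set A = {x : f₀(x) > γ* f₁(x)} satisfies ∫_A (π₀ f₀ + π₁ f₁) dμ = b π₀. Then for every measurable set B ⊆ ℝ^d with ∫_B (π₀ f₀ + π₁ f₁) dμ ≤ b π₀, one has ∫_B f₀ dμ ≤ ∫_A f₀ dμ. In other words, the capacity-constrained classifier g_b that assigns the minority label 0 exactly on A maximizes the detection probability P(g(X)=0 | Y=0) over all classifiers g satisfying the capacity constraint P(g(X)=0) ≤ b π₀. -/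
open MeasureTheory

/-- **Optimality of the capacity-constrained classifier (Neyman–Pearson form).**
Let `μ` be Lebesgue measure on `ℝ^d`, `f₀, f₁` probability densities, class
probabilities `π₀, π₁ > 0` with `π₀ + π₁ = 1`, and capacity level `0 < b ≤ 1/π₀`.
If `γ* ≥ 0` is such that `A = {x | f₀ x > γ* f₁ x}` has mixture mass
`∫_A (π₀ f₀ + π₁ f₁) = b π₀`, then for every measurable set `B` with
`∫_B (π₀ f₀ + π₁ f₁) ≤ b π₀` one has `∫_B f₀ ≤ ∫_A f₀`. -/
theorem capacity_constrained_classifier_optimal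
    (d : ℕ) (f₀ f₁ : (Fin d → ℝ) → ℝ)
    (hf₀m : Measurable f₀) (hf₁m : Measurable f₁)
    (hf₀0 : ∀ x, 0 ≤ f₀ x) (hf₁0 : ∀ x, 0 ≤ f₁ x)
    (hf₀1 : ∫ x, f₀ x = 1) (hf₁1 : ∫ x, f₁ x = 1)
    (π₀ π₁ b γstar : ℝ)
    (hπ₀ : 0 < π₀) (hπ₁ : 0 < π₁) (hπ : π₀ + π₁ = 1)
    (hb0 : 0 < b) (hb1 : b ≤ 1 / π₀) (hγ : 0 ≤ γstar)
    (hA : ∫ x in {x | f₀ x > γstar * f₁ x}, (π₀ * f₀ x + π₁ * f₁ x) = b * π₀) :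
    ∀ B : Set (Fin d → ℝ), MeasurableSet B →
      (∫ x in B, (π₀ * f₀ x + π₁ * f₁ x)) ≤ b * π₀ →
      (∫ x in B, f₀ x) ≤ ∫ x in {x | f₀ x > γstar * f₁ x}, f₀ x := by
  intro B hB hcap
  have i0 : Integrable f₀ := by
    by_contra h
    rw [integral_undef h] at hf₀1
    exact zero_ne_one hf₀1
  have i1 : Integrable f₁ := by
    by_contra h
    rw [integral_undef h] at hf₁1
    exact zero_ne_one hf₁1
  have hAm : MeasurableSet {x | f₀ x > γstar * f₁ x} :=
    measurableSet_lt (hf₁m.const_mul γstar) hf₀m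
  have ih : Integrable (fun x => f₀ x - γstar * f₁ x) := i0.sub (i1.const_mul γstar)
  have key : (∫ x in B, (f₀ x - γstar * f₁ x))
      ≤ ∫ x in {x | f₀ x > γstar * f₁ x}, (f₀ x - γstar * f₁ x) := by
    rw [← integral_indicator hB, ← integral_indicator hAm]
    refine integral_mono (ih.indicator hB) (ih.indicator hAm) ?_
    intro x
    classical
    rw [Set.indicator_apply, Set.indicator_apply]
    simp only [Set.mem_ofPred_eq]
    split_ifs <;> linarith
  have e1 : ∀ S : Set (Fin d → ℝ), (∫ x in S, (f₀ x - γstar * f₁ x))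
      = (∫ x in S, f₀ x) - γstar * ∫ x in S, f₁ x := by
    intro S
    rw [integral_sub i0.integrableOn (i1.const_mul γstar).integrableOn, integral_const_mul]
  have e2 : ∀ S : Set (Fin d → ℝ), (∫ x in S, (π₀ * f₀ x + π₁ * f₁ x))
      = π₀ * (∫ x in S, f₀ x) + π₁ * ∫ x in S, f₁ x := by
    intro S
    rw [integral_add (i0.const_mul π₀).integrableOn (i1.const_mul π₁).integrableOn,
      integral_const_mul, integral_const_mul]
  rw [← hA, e2, e2] at hcap
  rw [e1, e1] at key
  have hpos : 0 < π₁ + γstar * π₀ := by positivity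
  refine le_of_mul_le_mul_left ?_ hpos
  have h1 := mul_le_mul_of_nonneg_left key hπ₁.le
  have h2 := mul_le_mul_of_nonneg_left hcap hγ
  linarith
end

section
/- Let μ be Lebesgue measure on ℝ^d, let f₀, f₁ : ℝ^d → [0,∞) be measurable probability densities with respect to μ, let π₀, π₁ > 0 with π₀ + π₁ = 1, and let 0 < b ≤ 1/π₀. Suppose γ* ≥ 0 is such that A = {x : f₀(x) > γ* f₁(x)} satisfies ∫_A (π₀ f₀ + π₁ f₁) dμ = b π₀. For a measurable classifier g : ℝ^d → {0,1}, write p(g) = ∫_{{g=0}} (π₀ f₀ + π₁ f₁) dμ and s(g) = ∫_{{g=0}} f₀ dμ, and define the capacity-adjusted performance M(g) = s(g) if p(g) ≤ b π₀, and M(g) = s(g) · (b π₀ / p(g)) if p(g) > b π₀. Then for every measurable classifier g, M(g) ≤ ∫_A f₀ dμ, i.e., the capacity-constrained classifier g_b (which assigns label 0 exactly on A) maximizes M. -/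
open MeasureTheory
open scoped Classical

/-- **The capacity-constrained classifier maximizes the capacity-adjusted
performance measure `M`.** For a measurable classifier `g : ℝ^d → {0,1}`
(label `0` encoded by `false`), with selection rate
`p(g) = ∫_{g=0} (π₀ f₀ + π₁ f₁)` and detection probability `s(g) = ∫_{g=0} f₀`,
the capacity-adjusted performance `M(g)` (equal to `s(g)` when `p(g) ≤ b π₀`
and to `s(g)·(b π₀ / p(g))` otherwise) is at most `∫_A f₀`, where
`A = {x | f₀ x > γ* f₁ x}` satisfies `∫_A (π₀ f₀ + π₁ f₁) = b π₀`. -/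
theorem capacity_constrained_classifier_maximizes_M
    (d : ℕ) (f₀ f₁ : (Fin d → ℝ) → ℝ)
    (hf₀m : Measurable f₀) (hf₁m : Measurable f₁)
    (hf₀0 : ∀ x, 0 ≤ f₀ x) (hf₁0 : ∀ x, 0 ≤ f₁ x)
    (hf₀1 : ∫ x, f₀ x = 1) (hf₁1 : ∫ x, f₁ x = 1)
    (π₀ π₁ b γstar : ℝ)
    (hπ₀ : 0 < π₀) (hπ₁ : 0 < π₁) (hπ : π₀ + π₁ = 1)
    (hb0 : 0 < b) (hb1 : b ≤ 1 / π₀) (hγ : 0 ≤ γstar)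
    (hA : ∫ x in {x | f₀ x > γstar * f₁ x}, (π₀ * f₀ x + π₁ * f₁ x) = b * π₀) :
    ∀ g : (Fin d → ℝ) → Bool, Measurable g →
      (if (∫ x in {x | g x = false}, (π₀ * f₀ x + π₁ * f₁ x)) ≤ b * π₀ then
          (∫ x in {x | g x = false}, f₀ x)
        else
          (∫ x in {x | g x = false}, f₀ x) *
            (b * π₀ / ∫ x in {x | g x = false}, (π₀ * f₀ x + π₁ * f₁ x)))
        ≤ ∫ x in {x | f₀ x > γstar * f₁ x}, f₀ x := by
  intro g hg
  have i0 : Integrable f₀ := by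
    by_contra h
    rw [integral_undef h] at hf₀1
    norm_num at hf₀1
  have i1 : Integrable f₁ := by
    by_contra h
    rw [integral_undef h] at hf₁1
    norm_num at hf₁1
  have mA : MeasurableSet {x | f₀ x > γstar * f₁ x} :=
    measurableSet_lt (hf₁m.const_mul γstar) hf₀m
  have mB : MeasurableSet {x | g x = false} := hg (measurableSet_singleton false)
  have hsplit : ∀ S : Set (Fin d → ℝ), ∫ x in S, (π₀ * f₀ x + π₁ * f₁ x)
      = π₀ * (∫ x in S, f₀ x) + π₁ * ∫ x in S, f₁ x := by
    intro S
    rw [integral_add (i0.integrableOn.const_mul π₀) (i1.integrableOn.const_mul π₁),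
      integral_const_mul, integral_const_mul]
  have hsub : ∀ S : Set (Fin d → ℝ), ∫ x in S, (f₀ x - γstar * f₁ x)
      = (∫ x in S, f₀ x) - γstar * ∫ x in S, f₁ x := by
    intro S
    rw [integral_sub i0.integrableOn (i1.integrableOn.const_mul γstar), integral_const_mul]
  have ih : Integrable (fun x => f₀ x - γstar * f₁ x) := i0.sub (i1.const_mul γstar)
  have hcmp : ∫ x in {x | g x = false}, (f₀ x - γstar * f₁ x)
      ≤ ∫ x in {x | f₀ x > γstar * f₁ x}, (f₀ x - γstar * f₁ x) := by
    rw [← integral_indicator mB, ← integral_indicator mA]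
    refine integral_mono (ih.indicator mB) (ih.indicator mA) ?_
    intro x
    simp only [Set.indicator_apply, Set.mem_setOf_eq]
    split_ifs <;> linarith
  have hpos : 0 ≤ ∫ x in {x | f₀ x > γstar * f₁ x}, (f₀ x - γstar * f₁ x) := by
    refine setIntegral_nonneg mA ?_
    intro x hx
    simp only [Set.mem_setOf_eq] at hx
    linarith
  rw [hsub] at hpos
  rw [hsub, hsub] at hcmp
  rw [hsplit] at hA
  rw [hsplit]
  generalize (∫ x in {x | f₀ x > γstar * f₁ x}, f₀ x) = S at *
  generalize (∫ x in {x | f₀ x > γstar * f₁ x}, f₁ x) = T at *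
  generalize (∫ x in {x | g x = false}, f₀ x) = s at *
  generalize (∫ x in {x | g x = false}, f₁ x) = t at *
  have key : ∀ w : ℝ, 0 ≤ w → w ≤ 1 → w * (π₀ * s + π₁ * t) ≤ b * π₀ → s * w ≤ S := by
    intro w hw0 hw1 hw
    have h1 : w * (s - γstar * t) ≤ S - γstar * T :=
      (mul_le_mul_of_nonneg_left hcmp hw0).trans (mul_le_of_le_one_left hpos hw1)
    rw [← hA] at hw
    have h2 := mul_le_mul_of_nonneg_left h1 hπ₁.le
    have h3 := mul_le_mul_of_nonneg_left hw hγ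
    have h4 : 0 < π₁ + γstar * π₀ := by positivity
    refine le_of_mul_le_mul_left ?_ h4
    nlinarith
  have hbp : 0 < b * π₀ := mul_pos hb0 hπ₀
  split_ifs with hc
  · have := key 1 zero_le_one le_rfl (by linarith)
    linarith
  · push Not at hc
    have hp : 0 < π₀ * s + π₁ * t := hbp.trans hc
    refine key _ (by positivity) ((div_le_one hp).2 hc.le) ?_
    rw [div_mul_cancel₀ _ hp.ne']
end

section
/- Let μ be Lebesgue measure on ℝ^d, let f₀, f₁ : ℝ^d → [0,∞) be measurable probability densities with respect to μ, let π₀, π₁ > 0 with π₀ + π₁ = 1, and let 0 < b ≤ 1/π₀. Suppose γ* ≥ 0 is such that A = {x : f₀(x) > γ* f₁(x)} satisfies ∫_A (π₀ f₀ + π₁ f₁) dμ = b π₀. Then ∫_A f₀ dμ ≥ b π₀; equivalently, the detection probability of the capacity-constrained classifier satisfies P(g_b(X)=0 | Y=0) ≥ b π₀. -/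
open MeasureTheory

/-- **Lower bound on the detection probability of the capacity-constrained
classifier.** If `γ* ≥ 0` is such that `A = {x | f₀ x > γ* f₁ x}` has mixture
mass `∫_A (π₀ f₀ + π₁ f₁) = b π₀`, then `∫_A f₀ ≥ b π₀`, i.e.
`P(g_b(X)=0 | Y=0) ≥ b π₀`. -/
theorem capacity_constrained_detection_lower_bound
    (d : ℕ) (f₀ f₁ : (Fin d → ℝ) → ℝ)
    (hf₀m : Measurable f₀) (hf₁m : Measurable f₁)
    (hf₀0 : ∀ x, 0 ≤ f₀ x) (hf₁0 : ∀ x, 0 ≤ f₁ x)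
    (hf₀1 : ∫ x, f₀ x = 1) (hf₁1 : ∫ x, f₁ x = 1)
    (π₀ π₁ b γstar : ℝ)
    (hπ₀ : 0 < π₀) (hπ₁ : 0 < π₁) (hπ : π₀ + π₁ = 1)
    (hb0 : 0 < b) (hb1 : b ≤ 1 / π₀) (hγ : 0 ≤ γstar)
    (hA : ∫ x in {x | f₀ x > γstar * f₁ x}, (π₀ * f₀ x + π₁ * f₁ x) = b * π₀) :
    b * π₀ ≤ ∫ x in {x | f₀ x > γstar * f₁ x}, f₀ x := by
  have hi₀ : Integrable f₀ := by
    by_contra h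
    rw [integral_undef h] at hf₀1
    norm_num at hf₀1
  have hi₁ : Integrable f₁ := by
    by_contra h
    rw [integral_undef h] at hf₁1
    norm_num at hf₁1
  have hAm : MeasurableSet {x | f₀ x > γstar * f₁ x} :=
    measurableSet_lt (hf₁m.const_mul γstar) hf₀m
  have hle : ∫ x in {x | f₀ x > γstar * f₁ x}, f₁ x
      ≤ ∫ x in {x | f₀ x > γstar * f₁ x}, f₀ x := by
    rcases le_total 1 γstar with h | h
    · refine setIntegral_mono_on hi₁.integrableOn hi₀.integrableOn hAm ?_
      intro x hx
      have hx' : γstar * f₁ x < f₀ x := hx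
      nlinarith [hf₁0 x]
    · have hc : ∫ x in {x | f₀ x > γstar * f₁ x}ᶜ, f₀ x
          ≤ ∫ x in {x | f₀ x > γstar * f₁ x}ᶜ, f₁ x := by
        refine setIntegral_mono_on hi₀.integrableOn hi₁.integrableOn hAm.compl ?_
        intro x hx
        have hx' : f₀ x ≤ γstar * f₁ x := not_lt.mp hx
        nlinarith [hf₁0 x]
      have e₀ := integral_add_compl hAm hi₀
      have e₁ := integral_add_compl hAm hi₁
      linarith
  rw [integral_add (hi₀.integrableOn.const_mul π₀) (hi₁.integrableOn.const_mul π₁),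
    integral_const_mul, integral_const_mul] at hA
  rw [← hA]
  have hp : π₀ = 1 - π₁ := by linarith
  rw [hp]
  nlinarith
end

section
/- Let μ be Lebesgue measure on ℝ^d, let f₀, f₁ : ℝ^d → [0,∞) be measurable probability densities with respect to μ, let π₀, π₁ > 0 with π₀ + π₁ = 1, and let 0 < b ≤ 1/π₀. Suppose γ* ≥ 0 is such that A = {x : f₀(x) > γ* f₁(x)} satisfies ∫_A (π₀ f₀ + π₁ f₁) dμ = b π₀. Then the overall accuracy of the capacity-constrained classifier g_b satisfies π₀ ∫_A f₀ dμ + π₁ (1 − ∫_A f₁ dμ) ≥ π₁ − b π₀ (1 − 2 π₀); equivalently, P(g_b(X) = Y) ≥ π₁ − b π₀ (1 − 2 π₀), so its misclassification probability R(g_b) = P(g_b(X) ≠ Y) is at most 1 − π₁ + b π₀ (1 − 2 π₀). -/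
open MeasureTheory

/-- **Accuracy bound for the capacity-constrained classifier.** If `γ* ≥ 0` is
such that `A = {x | f₀ x > γ* f₁ x}` has mixture mass
`∫_A (π₀ f₀ + π₁ f₁) = b π₀`, then the accuracy of the classifier assigning
label `0` exactly on `A` satisfies
`π₀ ∫_A f₀ + π₁ (1 − ∫_A f₁) ≥ π₁ − b π₀ (1 − 2 π₀)`, equivalently the
misclassification probability is at most `1 − π₁ + b π₀ (1 − 2 π₀)`. -/
theorem capacity_constrained_accuracy_bound
    (d : ℕ) (f₀ f₁ : (Fin d → ℝ) → ℝ)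
    (hf₀m : Measurable f₀) (hf₁m : Measurable f₁)
    (hf₀0 : ∀ x, 0 ≤ f₀ x) (hf₁0 : ∀ x, 0 ≤ f₁ x)
    (hf₀1 : ∫ x, f₀ x = 1) (hf₁1 : ∫ x, f₁ x = 1)
    (π₀ π₁ b γstar : ℝ)
    (hπ₀ : 0 < π₀) (hπ₁ : 0 < π₁) (hπ : π₀ + π₁ = 1)
    (hb0 : 0 < b) (hb1 : b ≤ 1 / π₀) (hγ : 0 ≤ γstar)
    (hA : ∫ x in {x | f₀ x > γstar * f₁ x}, (π₀ * f₀ x + π₁ * f₁ x) = b * π₀) :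
    π₁ - b * π₀ * (1 - 2 * π₀) ≤
      π₀ * (∫ x in {x | f₀ x > γstar * f₁ x}, f₀ x) +
        π₁ * (1 - ∫ x in {x | f₀ x > γstar * f₁ x}, f₁ x) := by
  have i0 : Integrable f₀ := by
    by_contra h
    rw [integral_undef h] at hf₀1
    norm_num at hf₀1
  have i1 : Integrable f₁ := by
    by_contra h
    rw [integral_undef h] at hf₁1
    norm_num at hf₁1
  have hm : MeasurableSet {x | f₀ x > γstar * f₁ x} :=
    measurableSet_lt (hf₁m.const_mul γstar) hf₀m
  have key : ∫ x in {x | f₀ x > γstar * f₁ x}, f₁ x ≤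
      ∫ x in {x | f₀ x > γstar * f₁ x}, f₀ x := by
    rcases le_total 1 γstar with h | h
    · refine setIntegral_mono_on i1.integrableOn i0.integrableOn hm ?_
      intro x hx
      have hx' : γstar * f₁ x < f₀ x := hx
      nlinarith [hf₁0 x]
    · have h2 : ∫ x in {x | f₀ x > γstar * f₁ x}ᶜ, f₀ x ≤
          ∫ x in {x | f₀ x > γstar * f₁ x}ᶜ, f₁ x := by
        refine setIntegral_mono_on i0.integrableOn i1.integrableOn hm.compl ?_
        intro x hx
        have hx' : f₀ x ≤ γstar * f₁ x := not_lt.mp hx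
        nlinarith [hf₁0 x]
      have e0 := integral_add_compl hm i0
      have e1 := integral_add_compl hm i1
      linarith
  rw [integral_add (i0.integrableOn.const_mul π₀) (i1.integrableOn.const_mul π₁),
    integral_const_mul, integral_const_mul] at hA
  rw [← hA]
  generalize (∫ x in {x | f₀ x > γstar * f₁ x}, f₀ x) = a at *
  generalize (∫ x in {x | f₀ x > γstar * f₁ x}, f₁ x) = c at *
  have hp : π₁ = 1 - π₀ := by linarith
  have := mul_nonneg (mul_pos hπ₀ hπ₁).le (sub_nonneg.mpr key)
  subst hp
  nlinarith
end

section
/- Let μ be Lebesgue measure on ℝ^d, let f₀, f₁ : ℝ^d → [0,∞) be measurable probability densities with respect to μ, and let π₀, π₁ > 0 with π₀ + π₁ = 1. For γ ≥ 0 set A_γ = {x : f₀(x) > γ f₁(x)} and P_γ = ∫_{A_γ} (π₀ f₀ + π₁ f₁) dμ. Assume that for every γ ≥ 0 the set {x : f₀(x) = γ f₁(x)} has (π₀ f₀ + π₁ f₁)·μ-measure zero, and that the set {x : f₁(x) = 0 and f₀(x) > 0} is μ-null. Then the map γ ↦ P_γ is non-increasing and continuous on [0,∞), P_γ → 0 as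 γ → ∞, and for every t with 0 < t ≤ P_0 there exists γ* ≥ 0 with P_{γ*} = t. In particular, if b π₀ ≤ P_0 then the threshold γ* defining the capacity-constrained classifier g_b (via P_{γ*} = b π₀) exists. -/
open MeasureTheory Filter

/-- The selection probability `P_γ = ∫_{A_γ} (π₀ f₀ + π₁ f₁) dμ` of the
likelihood-ratio superlevel set `A_γ = {x | f₀ x > γ f₁ x}`. -/
noncomputable def Pgamma (d : ℕ) (f₀ f₁ : (Fin d → ℝ) → ℝ) (π₀ π₁ : ℝ) (γ : ℝ) : ℝ :=
  ∫ x in {x | f₀ x > γ * f₁ x}, (π₀ * f₀ x + π₁ * f₁ x)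

/-- **Existence of the capacity threshold `γ*`.** Assume the level sets
`{x | f₀ x = γ f₁ x}` carry no mixture mass for every `γ ≥ 0` and that
`{x | f₁ x = 0 ∧ f₀ x > 0}` is Lebesgue-null. Then `γ ↦ P_γ` is non-increasing
and continuous on `[0,∞)`, tends to `0` at infinity, attains every value
`t ∈ (0, P_0]`, and in particular if `b π₀ ≤ P_0` there exists `γ* ≥ 0` with
`P_{γ*} = b π₀`, defining the capacity-constrained classifier `g_b`. -/
theorem Pgamma_properties_and_threshold_existence
    (d : ℕ) (f₀ f₁ : (Fin d → ℝ) → ℝ)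
    (hf₀m : Measurable f₀) (hf₁m : Measurable f₁)
    (hf₀0 : ∀ x, 0 ≤ f₀ x) (hf₁0 : ∀ x, 0 ≤ f₁ x)
    (hf₀1 : ∫ x, f₀ x = 1) (hf₁1 : ∫ x, f₁ x = 1)
    (π₀ π₁ : ℝ) (hπ₀ : 0 < π₀) (hπ₁ : 0 < π₁) (hπ : π₀ + π₁ = 1)
    (hlevel : ∀ γ : ℝ, 0 ≤ γ →
      (∫ x in {x | f₀ x = γ * f₁ x}, (π₀ * f₀ x + π₁ * f₁ x)) = 0)
    (hnull : volume {x : Fin d → ℝ | f₁ x = 0 ∧ 0 < f₀ x} = 0)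
    (b : ℝ) (hb : 0 < b) :
    AntitoneOn (Pgamma d f₀ f₁ π₀ π₁) (Set.Ici 0) ∧
    ContinuousOn (Pgamma d f₀ f₁ π₀ π₁) (Set.Ici 0) ∧
    Tendsto (Pgamma d f₀ f₁ π₀ π₁) atTop (nhds 0) ∧
    (∀ t : ℝ, 0 < t → t ≤ Pgamma d f₀ f₁ π₀ π₁ 0 →
      ∃ γ : ℝ, 0 ≤ γ ∧ Pgamma d f₀ f₁ π₀ π₁ γ = t) ∧
    (b * π₀ ≤ Pgamma d f₀ f₁ π₀ π₁ 0 →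
      ∃ γstar : ℝ, 0 ≤ γstar ∧ Pgamma d f₀ f₁ π₀ π₁ γstar = b * π₀) := by
  have hi₀ : Integrable f₀ := by
    by_contra h
    rw [integral_undef h] at hf₀1
    exact zero_ne_one hf₀1
  have hi₁ : Integrable f₁ := by
    by_contra h
    rw [integral_undef h] at hf₁1
    exact zero_ne_one hf₁1
  have hw : Integrable (fun x => π₀ * f₀ x + π₁ * f₁ x) :=
    (hi₀.const_mul π₀).add (hi₁.const_mul π₁)
  have hw0 : ∀ x, 0 ≤ π₀ * f₀ x + π₁ * f₁ x := fun x =>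
    add_nonneg (mul_nonneg hπ₀.le (hf₀0 x)) (mul_nonneg hπ₁.le (hf₁0 x))
  have hA : ∀ γ : ℝ, MeasurableSet {x | f₀ x > γ * f₁ x} := fun γ =>
    measurableSet_lt (hf₁m.const_mul γ) hf₀m
  have hE : ∀ γ : ℝ, MeasurableSet {x | f₀ x = γ * f₁ x} := fun γ =>
    measurableSet_eq_fun hf₀m (hf₁m.const_mul γ)
  have hP : ∀ γ, Pgamma d f₀ f₁ π₀ π₁ γ =
      ∫ x, Set.indicator {x | f₀ x > γ * f₁ x} (fun x => π₀ * f₀ x + π₁ * f₁ x) x := by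
    intro γ
    rw [integral_indicator (hA γ)]
    rfl
  have hbd : ∀ (γ : ℝ) x, ‖Set.indicator {x | f₀ x > γ * f₁ x}
      (fun x => π₀ * f₀ x + π₁ * f₁ x) x‖ ≤ π₀ * f₀ x + π₁ * f₁ x := by
    intro γ x
    refine (norm_indicator_le_norm_self _ _).trans ?_
    rw [Real.norm_of_nonneg (hw0 x)]
  have hanti : AntitoneOn (Pgamma d f₀ f₁ π₀ π₁) (Set.Ici 0) := by
    intro a _ c _ hac
    refine setIntegral_mono_set hw.integrableOn (Eventually.of_forall hw0) ?_
    refine LE.le.eventuallyLE ?_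
    intro x hx
    exact lt_of_le_of_lt (mul_le_mul_of_nonneg_right hac (hf₁0 x)) hx
  have hcont : ContinuousOn (Pgamma d f₀ f₁ π₀ π₁) (Set.Ici 0) := by
    intro γ hγ
    apply ContinuousAt.continuousWithinAt
    have hae : ∀ᵐ x, f₀ x = γ * f₁ x → π₀ * f₀ x + π₁ * f₁ x = 0 := by
      have h := (setIntegral_eq_zero_iff_of_nonneg_ae
        (Eventually.of_forall hw0) hw.integrableOn).1 (hlevel γ hγ)
      exact (ae_restrict_iff' (hE γ)).1 h
    unfold ContinuousAt
    rw [hP γ, show Pgamma d f₀ f₁ π₀ π₁ = _ from funext hP]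
    refine tendsto_integral_filter_of_dominated_convergence
      (fun x => π₀ * f₀ x + π₁ * f₁ x)
      (Eventually.of_forall fun c => (hw.indicator (hA c)).aestronglyMeasurable)
      (Eventually.of_forall fun c => Eventually.of_forall (hbd c)) hw ?_
    filter_upwards [hae] with x hx
    have hc : Continuous fun c : ℝ => c * f₁ x := by fun_prop
    apply tendsto_const_nhds.congr'
    rcases lt_trichotomy (f₀ x) (γ * f₁ x) with h | h | h
    · filter_upwards [hc.continuousAt.eventually_const_lt h] with c hc
      simp [Set.indicator, not_lt.2 h.le, not_lt.2 hc.le]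
    · filter_upwards with c
      simp [Set.indicator, hx h]
    · filter_upwards [hc.continuousAt.eventually_lt_const h] with c hc
      simp [Set.indicator, h, hc]
  have hlim : Tendsto (Pgamma d f₀ f₁ π₀ π₁) atTop (nhds 0) := by
    have hae : ∀ᵐ x : Fin d → ℝ, ¬ (f₁ x = 0 ∧ 0 < f₀ x) := by
      rw [ae_iff]
      simpa only [not_not] using hnull
    have h0 : (0 : ℝ) = ∫ x : Fin d → ℝ, (0 : ℝ) := by simp
    rw [h0, show Pgamma d f₀ f₁ π₀ π₁ = _ from funext hP]
    refine tendsto_integral_filter_of_dominated_convergence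
      (fun x => π₀ * f₀ x + π₁ * f₁ x)
      (Eventually.of_forall fun c => (hw.indicator (hA c)).aestronglyMeasurable)
      (Eventually.of_forall fun c => Eventually.of_forall (hbd c)) hw ?_
    filter_upwards [hae] with x hx
    apply tendsto_const_nhds.congr'
    filter_upwards [eventually_ge_atTop (f₀ x / f₁ x)] with c hc
    have : ¬ (c * f₁ x < f₀ x) := by
      intro hlt
      rcases (hf₁0 x).eq_or_lt with h | h
      · exact hx ⟨h.symm, by simpa [← h] using hlt⟩
      · exact absurd ((div_le_iff₀ h).1 hc) (not_le.2 hlt)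
    simp [Set.indicator, this]
  have hex : ∀ t : ℝ, 0 < t → t ≤ Pgamma d f₀ f₁ π₀ π₁ 0 →
      ∃ γ : ℝ, 0 ≤ γ ∧ Pgamma d f₀ f₁ π₀ π₁ γ = t := by
    intro t ht ht0
    obtain ⟨c, hc, hc0⟩ := ((hlim.eventually_lt_const ht).and (eventually_ge_atTop 0)).exists
    obtain ⟨γ, hγ, h⟩ := intermediate_value_Icc' hc0
      (hcont.mono Set.Icc_subset_Ici_self) ⟨hc.le, ht0⟩
    exact ⟨γ, hγ.1, h⟩
  exact ⟨hanti, hcont, hlim, hex, hex _ (mul_pos hb hπ₀)⟩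
end

section
/- Let μ be a probability measure on ℝ^d. Let f_n, g_n, f, g : ℝ^d → [0,∞) be measurable functions (probability densities) such that f_n → f and g_n → g in μ-measure, and let γ_n be a sequence of real numbers with γ_n → γ. Define E_n = {x : f_n(x) > γ_n g_n(x)} and E = {x : f(x) > γ g(x)}. If μ({x : f(x) = γ g(x)}) = 0, then μ(E_n Δ E) → 0 as n → ∞, where Δ denotes symmetric difference. -/
open MeasureTheory Filter
open scoped symmDiff

/-- **Lemma 1: stability of likelihood-ratio superlevel sets.** Let `μ` be a
probability measure on `ℝ^d`, `fₙ → f` and `gₙ → g` in `μ`-measure, and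
`γₙ → γ` in `ℝ`. Set `Eₙ = {x | fₙ x > γₙ gₙ x}` and `E = {x | f x > γ g x}`.
If `μ {x | f x = γ g x} = 0`, then `μ (Eₙ Δ E) → 0`. -/
theorem measure_symmDiff_superlevel_tendsto_zero
    (d : ℕ) (μ : Measure (Fin d → ℝ)) [IsProbabilityMeasure μ]
    (fn gn : ℕ → (Fin d → ℝ) → ℝ) (f g : (Fin d → ℝ) → ℝ)
    (hfnm : ∀ n, Measurable (fn n)) (hgnm : ∀ n, Measurable (gn n))
    (hfm : Measurable f) (hgm : Measurable g)
    (hfn0 : ∀ n x, 0 ≤ fn n x) (hgn0 : ∀ n x, 0 ≤ gn n x)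
    (hf0 : ∀ x, 0 ≤ f x) (hg0 : ∀ x, 0 ≤ g x)
    (hfconv : TendstoInMeasure μ fn atTop f)
    (hgconv : TendstoInMeasure μ gn atTop g)
    (γn : ℕ → ℝ) (γ : ℝ) (hγconv : Tendsto γn atTop (nhds γ))
    (hnull : μ {x | f x = γ * g x} = 0) :
    Tendsto (fun n => μ ({x | fn n x > γn n * gn n x} ∆ {x | f x > γ * g x}))
      atTop (nhds 0) := by
  refine tendsto_of_subseq_tendsto fun ns hns => ?_
  obtain ⟨a, ha, hfa⟩ := (hfconv.comp hns).exists_seq_tendsto_ae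
  obtain ⟨b, hb, hgb⟩ := ((hgconv.comp hns).comp ha.tendsto_atTop).exists_seq_tendsto_ae
  refine ⟨fun k => a (b k), ?_⟩
  have hne : ∀ᵐ x ∂μ, f x ≠ γ * g x := by
    rw [ae_iff]
    simpa using hnull
  have hγ' : Tendsto (fun k => γn (ns (a (b k)))) atTop (nhds γ) :=
    hγconv.comp (hns.comp (ha.tendsto_atTop.comp hb.tendsto_atTop))
  rw [← measure_empty (μ := μ)]
  refine tendsto_measure_of_ae_tendsto_indicator_of_isFiniteMeasure (μ := μ) atTop
    MeasurableSet.empty (fun k => ?_) ?_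
  · exact (measurableSet_lt ((hgnm _).const_mul _) (hfnm _)).symmDiff
      (measurableSet_lt (hgm.const_mul _) hfm)
  · filter_upwards [hfa, hgb, hne] with x hx1 hx2 hx3
    have h1 : Tendsto (fun k => fn (ns (a (b k))) x) atTop (nhds (f x)) :=
      hx1.comp hb.tendsto_atTop
    have h2 : Tendsto (fun k => γn (ns (a (b k))) * gn (ns (a (b k))) x) atTop
        (nhds (γ * g x)) := hγ'.mul hx2
    rcases lt_or_gt_of_ne hx3 with h | h
    · filter_upwards [h1.eventually_lt h2 h] with k hk
      simp [Set.mem_symmDiff, hk.le, h.le]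
    · filter_upwards [h2.eventually_lt h1 h] with k hk
      have h' : γ * g x < f x := h
      simp [Set.mem_symmDiff, hk, h']
end

section
/- Let X be a random vector in ℝ^d with distribution P_X, let η : ℝ^d → [0,1] be measurable, and let τ ∈ ℝ with P_X({x : η(x) = 1/2 + τ}) = 0. On a probability space (Ω, ℱ, P), let η̂_n : Ω × ℝ^d → ℝ be jointly measurable random functions and τ̂_n : Ω → ℝ random variables such that: (i) for P_X-almost every x, η̂_n(·, x) → η(x) in probability; (ii) τ̂_n → τ in probability. Define the plug-in classifiers ĝ_n(ω, x) = sign(η̂_n(ω, x) − 1/2 − τ̂_n(ω)) and the population classifier g*(x) = sign(η(x) − 1/2 − τ). Then (P ⊗ P_X)({(ω, x) : ĝ_n(ω, x) ≠ g*(x)}) → 0 as n → ∞; that is, the probability that the thresholded plug-in rule disagrees with its population counterpart tends to zero. -/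
open MeasureTheory Filter

/-- The sign function with values in `{−1, 1}`: `sign t = 1` if `t ≥ 0` and
`−1` if `t < 0`. -/
noncomputable def sgn (t : ℝ) : ℝ := if 0 ≤ t then 1 else -1

/-- **Consistency of the thresholded plug-in classifier.** Let `P_X` be the
distribution of `X` on `ℝ^d`, `η : ℝ^d → [0,1]` measurable, `τ ∈ ℝ` with
`P_X {x | η x = 1/2 + τ} = 0`. Let `η̂ₙ` be jointly measurable random
regression estimates with `η̂ₙ(·,x) → η(x)` in probability for `P_X`-a.e. `x`,
and `τ̂ₙ → τ` in probability. Then the plug-in classifiers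
`ĝₙ(ω,x) = sign(η̂ₙ(ω,x) − 1/2 − τ̂ₙ(ω))` satisfy
`(P ⊗ P_X) {(ω,x) | ĝₙ(ω,x) ≠ g*(x)} → 0`, where
`g*(x) = sign(η(x) − 1/2 − τ)`. -/
theorem plugin_threshold_classifier_consistent
    (d : ℕ) (PX : Measure (Fin d → ℝ)) [IsProbabilityMeasure PX]
    (η : (Fin d → ℝ) → ℝ) (hηm : Measurable η) (hη01 : ∀ x, η x ∈ Set.Icc (0:ℝ) 1)
    (τ : ℝ) (hτnull : PX {x | η x = 1/2 + τ} = 0)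
    {Ω : Type*} [MeasurableSpace Ω] (P : Measure Ω) [IsProbabilityMeasure P]
    (ηhat : ℕ → Ω × (Fin d → ℝ) → ℝ) (hηhatm : ∀ n, Measurable (ηhat n))
    (τhat : ℕ → Ω → ℝ) (hτhatm : ∀ n, Measurable (τhat n))
    (hηconv : ∀ᵐ x ∂PX, ∀ ε : ℝ, 0 < ε →
      Tendsto (fun n => P {ω | ε < |ηhat n (ω, x) - η x|}) atTop (nhds 0))
    (hτconv : ∀ ε : ℝ, 0 < ε →
      Tendsto (fun n => P {ω | ε < |τhat n ω - τ|}) atTop (nhds 0)) :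
    Tendsto (fun n => (P.prod PX)
        {p : Ω × (Fin d → ℝ) |
          sgn (ηhat n p - 1/2 - τhat n p.1) ≠ sgn (η p.2 - 1/2 - τ)})
      atTop (nhds 0) := by
  have hsgn : Measurable sgn :=
    Measurable.ite measurableSet_Ici measurable_const measurable_const
  have hS : ∀ n, MeasurableSet {p : Ω × (Fin d → ℝ) |
      sgn (ηhat n p - 1/2 - τhat n p.1) ≠ sgn (η p.2 - 1/2 - τ)} := by
    intro n
    have h1 : Measurable fun p : Ω × (Fin d → ℝ) => sgn (ηhat n p - 1/2 - τhat n p.1) :=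
      hsgn.comp (((hηhatm n).sub_const _).sub ((hτhatm n).comp measurable_fst))
    have h2 : Measurable fun p : Ω × (Fin d → ℝ) => sgn (η p.2 - 1/2 - τ) :=
      hsgn.comp (((hηm.comp measurable_snd).sub_const _).sub_const _)
    exact (measurableSet_eq_fun h1 h2).compl
  simp_rw [fun n => Measure.prod_apply_symm (μ := P) (ν := PX) (hS n)]
  rw [← lintegral_zero (μ := PX)]
  refine tendsto_lintegral_of_dominated_convergence (fun _ => 1)
    (fun n => measurable_measure_prodMk_right (hS n))
    (fun n => Eventually.of_forall fun x => prob_le_one) (by simp) ?_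
  have hne : ∀ᵐ x ∂PX, η x ≠ 1/2 + τ := by
    rw [ae_iff]; simpa using hτnull
  filter_upwards [hηconv, hne] with x hx hxne
  have hc : 0 < |η x - 1/2 - τ| := abs_pos.mpr fun h => hxne (by linarith)
  have hε : 0 < |η x - 1/2 - τ| / 3 := by positivity
  have hsum := (hx _ hε).add (hτconv _ hε)
  rw [add_zero] at hsum
  refine tendsto_of_tendsto_of_tendsto_of_le_of_le tendsto_const_nhds hsum
    (fun _ => zero_le) fun n => ?_
  refine (measure_mono ?_).trans (measure_union_le _ _)
  intro ω hω
  by_contra hcon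
  simp only [Set.mem_union, Set.mem_ofPred_eq, not_or, not_lt] at hcon
  obtain ⟨h1, h2⟩ := hcon
  apply hω
  have h1' := abs_le.mp h1
  have h2' := abs_le.mp h2
  simp only [sgn]
  rcases le_or_gt 0 (η x - 1/2 - τ) with h | h
  · rw [abs_of_nonneg h] at h1' h2' hc
    rw [if_pos h, if_pos (by linarith [h1'.1, h2'.2])]
  · rw [abs_of_neg h] at h1' h2' hc
    rw [if_neg (not_le.mpr h), if_neg (not_le.mpr (by linarith [h1'.2, h2'.1]))]
end
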